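/- With s(d,m) ∈ ℤ[q] the generating polynomial of basal billiard partitions with d parts and largest part m, the following recursions hold: s(d, 2n) = q^{2n}·(s(d−1, 2n−2) + s(d−1, 2n−1)) for all d ≥ 2 and n ≥ 2, and s(d, 2n+1) = q^{2n+1}·s(d−1, 2n) for all d ≥ 2 and n ≥ 1. -/

import Mathlib

/-- An Euclidean billiard partition, recorded as the strictly decreasing list
of its parts: a nonempty strictly decreasing list of positive integers whose
smallest (last) part is even and in which no two adjacent parts are both odd. -/
def IsEBP (l : List ℕ) : Prop :=
  l ≠ [] ∧ l.Chain' (fun a b => b < a) ∧ (∀ x ∈ l, 0 < x) ∧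
    (∀ m ∈ l.getLast?, Even m) ∧ l.Chain' (fun a b => ¬(Odd a ∧ Odd b))

/-- A basal billiard partition: an Euclidean billiard partition whose smallest
part equals `2` and in which adjacent parts differ by at most `2`. -/
def IsBasal (l : List ℕ) : Prop :=
  IsEBP l ∧ l.getLast? = some 2 ∧ l.Chain' (fun a b => a - b ≤ 2)

open Classical Polynomial in
/-- `s d m ∈ ℤ[q]` is the generating polynomial `∑_π q^{|π|}` of basal billiard
partitions `π` with exactly `d` parts and largest part `m` (such a partition has
all parts `≤ m`, hence is encoded as a function `Fin d → Fin (m+1)`, and each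
basal billiard partition with `d` parts and largest part `m` occurs exactly once
in the sum below); in particular `s 0 m = 0`. -/
noncomputable def s (d m : ℕ) : Polynomial ℤ :=
  ∑ f : Fin d → Fin (m + 1),
    if IsBasal (List.ofFn fun i => (f i : ℕ)) ∧
        (List.ofFn fun i => (f i : ℕ)).head? = some m
    then X ^ (List.ofFn fun i => (f i : ℕ)).sum
    else 0

theorem basal_le {l : List ℕ} {m : ℕ} (h : IsBasal l) (hm : l.head? = some m) :
    ∀ x ∈ l, x ≤ m := by
  cases l with
  | nil => simp at hm
  | cons a t =>
    simp only [List.head?_cons, Option.some.injEq] at hm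
    subst hm
    have h1 : (a :: t).Pairwise (fun a b => b < a) := by
      haveI : IsTrans ℕ (fun a b => b < a) := ⟨fun a b c h1 h2 => lt_trans h2 h1⟩
      exact List.isChain_iff_pairwise.mp h.1.2.1
    intro x hx
    rcases List.mem_cons.mp hx with rfl | hx
    · exact le_rfl
    · exact (List.rel_of_pairwise_cons h1 hx).le

open Classical in
/-- The finite set of basal partitions with `d` parts and largest part `m`. -/
noncomputable def basalSet (d m : ℕ) : Finset (List ℕ) :=
  (Finset.univ.filter (fun f : Fin d → Fin (m + 1) =>
    IsBasal (List.ofFn fun i => (f i : ℕ)) ∧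
        (List.ofFn fun i => (f i : ℕ)).head? = some m)).image
    (fun f => List.ofFn fun i => (f i : ℕ))

theorem mem_basalSet {d m : ℕ} {l : List ℕ} :
    l ∈ basalSet d m ↔ IsBasal l ∧ l.head? = some m ∧ l.length = d := by
  classical
  simp only [basalSet, Finset.mem_image, Finset.mem_filter, Finset.mem_univ, true_and]
  constructor
  · rintro ⟨f, ⟨h1, h2⟩, rfl⟩
    exact ⟨h1, h2, by simp⟩
  · rintro ⟨h1, h2, rfl⟩
    have hle := basal_le h1 h2
    have e : (List.ofFn fun i : Fin l.length =>
        (((⟨l.get i, Nat.lt_succ_of_le (hle _ (List.get_mem l i))⟩ : Fin (m + 1))) : ℕ)) = l := by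
      simp
    refine ⟨fun i => ⟨l.get i, Nat.lt_succ_of_le (hle _ (List.get_mem l i))⟩, ⟨?_, ?_⟩, e⟩
    · rw [e]; exact h1
    · rw [e]; exact h2

open Polynomial in
theorem s_eq (d m : ℕ) : s d m = ∑ l ∈ basalSet d m, (X : Polynomial ℤ) ^ l.sum := by
  classical
  unfold s basalSet
  rw [Finset.sum_image, Finset.sum_filter]
  intro f _ g _ h
  have h' := List.ofFn_injective h
  funext i
  exact Fin.ext (congrFun h' i)

theorem basal_cons {a b : ℕ} {t : List ℕ} :
    IsBasal (a :: b :: t) ↔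
      IsBasal (b :: t) ∧ b < a ∧ a - b ≤ 2 ∧ ¬(Odd a ∧ Odd b) := by
  unfold IsBasal IsEBP
  simp only [List.Chain', List.isChain_cons_cons, List.getLast?_cons_cons, List.mem_cons, ne_eq,
    reduceCtorEq, not_false_eq_true, true_and, forall_eq_or_imp]
  constructor
  · rintro ⟨⟨⟨h1, h2⟩, ⟨h3, h4⟩, h5, h6, h7⟩, h8, h9, h10⟩
    exact ⟨⟨⟨h2, h4, h5, h7⟩, h8, h10⟩, h1, h9, h6⟩
  · rintro ⟨⟨⟨h2, h4, h5, h7⟩, h8, h10⟩, h1, h9, h6⟩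
    exact ⟨⟨⟨h1, h2⟩, ⟨by omega, h4⟩, h5, h6, h7⟩, h8, h9, h10⟩

theorem mem_basalSet_succ {d m : ℕ} {l : List ℕ} :
    l ∈ basalSet (d + 2) m ↔ ∃ b t, l = m :: b :: t ∧ (b :: t) ∈ basalSet (d + 1) b ∧
      b < m ∧ m - b ≤ 2 ∧ ¬(Odd m ∧ Odd b) := by
  rw [mem_basalSet]
  constructor
  · rintro ⟨h1, h2, h3⟩
    match l, h1, h2, h3 with
    | a :: b :: t, h1, h2, h3 =>
      simp only [List.head?_cons, Option.some.injEq] at h2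
      subst h2
      obtain ⟨h4, h5⟩ := basal_cons.mp h1
      exact ⟨b, t, rfl, mem_basalSet.mpr ⟨h4, rfl, by simpa using h3⟩, h5⟩
  · rintro ⟨b, t, rfl, h1, h2⟩
    obtain ⟨h3, -, h4⟩ := mem_basalSet.mp h1
    exact ⟨basal_cons.mpr ⟨h3, h2⟩, rfl, by simpa using h4⟩

theorem eq_cons_of_mem {d m : ℕ} {l : List ℕ} (h : l ∈ basalSet d m) : ∃ t, l = m :: t := by
  obtain ⟨-, h2, -⟩ := mem_basalSet.mp h
  cases l with
  | nil => simp at h2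
  | cons a t => simp at h2; exact ⟨t, by rw [h2]⟩

theorem basalSet_even (d n : ℕ) :
    basalSet (d + 2) (2 * n + 2) =
      (basalSet (d + 1) (2 * n) ∪ basalSet (d + 1) (2 * n + 1)).image
        (fun l => (2 * n + 2) :: l) := by
  ext l
  rw [mem_basalSet_succ]
  simp only [Finset.mem_image, Finset.mem_union]
  constructor
  · rintro ⟨b, t, rfl, h1, h2, h3, h4⟩
    refine ⟨_, ?_, rfl⟩
    have : b = 2 * n ∨ b = 2 * n + 1 := by omega
    rcases this with rfl | rfl
    · exact Or.inl h1
    · exact Or.inr h1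
  · have hodd : ¬ Odd (2 * n + 2) := by rw [Nat.odd_iff]; omega
    rintro ⟨l', h1 | h1, rfl⟩ <;> obtain ⟨t, rfl⟩ := eq_cons_of_mem h1
    · exact ⟨_, t, rfl, h1, by omega, by omega, fun h => hodd h.1⟩
    · exact ⟨_, t, rfl, h1, by omega, by omega, fun h => hodd h.1⟩

theorem basalSet_odd (d n : ℕ) :
    basalSet (d + 2) (2 * n + 1) =
      (basalSet (d + 1) (2 * n)).image (fun l => (2 * n + 1) :: l) := by
  ext l
  rw [mem_basalSet_succ]
  simp only [Finset.mem_image]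
  constructor
  · rintro ⟨b, t, rfl, h1, h2, h3, h4⟩
    refine ⟨_, ?_, rfl⟩
    rw [Nat.odd_iff, Nat.odd_iff] at h4
    have : b = 2 * n := by omega
    subst this
    exact h1
  · rintro ⟨l', h1, rfl⟩
    obtain ⟨t, rfl⟩ := eq_cons_of_mem h1
    refine ⟨_, t, rfl, h1, by omega, by omega, fun h => ?_⟩
    have := Nat.odd_iff.mp h.2
    omega

open Polynomial in
/-- The recursions `s(d, 2n) = q^{2n}(s(d−1, 2n−2) + s(d−1, 2n−1))` for `d ≥ 2`,
`n ≥ 2`, and `s(d, 2n+1) = q^{2n+1} s(d−1, 2n)` for `d ≥ 2`, `n ≥ 1`. -/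
theorem s_recursions :
    (∀ d n : ℕ, 2 ≤ d → 2 ≤ n →
      s d (2 * n) =
        X ^ (2 * n) * (s (d - 1) (2 * n - 2) + s (d - 1) (2 * n - 1))) ∧
    (∀ d n : ℕ, 2 ≤ d → 1 ≤ n →
      s d (2 * n + 1) = X ^ (2 * n + 1) * s (d - 1) (2 * n)) := by
  constructor
  · intro d n hd hn
    obtain ⟨d, rfl⟩ := Nat.exists_eq_add_of_le' hd
    obtain ⟨n, rfl⟩ := Nat.exists_eq_add_of_le' (le_trans one_le_two hn)
    have e1 : d + 2 - 1 = d + 1 := by omega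
    have e2 : 2 * (n + 1) - 2 = 2 * n := by omega
    have e3 : 2 * (n + 1) - 1 = 2 * n + 1 := by omega
    have e4 : 2 * (n + 1) = 2 * n + 2 := by omega
    rw [e1, e2, e3, e4, s_eq, s_eq, s_eq, basalSet_even, Finset.sum_image, Finset.sum_union,
      mul_add, Finset.mul_sum, Finset.mul_sum]
    · simp only [List.sum_cons, pow_add]
    · rw [Finset.disjoint_left]
      intro l h1 h2
      obtain ⟨t, rfl⟩ := eq_cons_of_mem h1
      obtain ⟨t', h⟩ := eq_cons_of_mem h2
      simp at h
    · intro a _ b _ h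
      simpa using h
  · intro d n hd hn
    obtain ⟨d, rfl⟩ := Nat.exists_eq_add_of_le' hd
    have e1 : d + 2 - 1 = d + 1 := by omega
    rw [e1, s_eq, s_eq, basalSet_odd, Finset.sum_image, Finset.mul_sum]
    · simp only [List.sum_cons, pow_add]
    · intro a _ b _ h
      simpa using h
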